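/- Let k ≥ 1 and let G be a family of intervals in Z/nZ that is intersecting and k-Sperner. Then Σ_{G ∈ G} C(n, |G|) ≤ n · Σ_I(n,k). -/

import Mathlib

/-- `Σ_I(n,k)` from the paper. -/
def SigmaI (n k : ℕ) : ℕ :=
  if n % 2 = 1 then
    ∑ i ∈ Finset.Icc ((n + 1) / 2) ((n + 1) / 2 + k - 1), Nat.choose n i
  else
    Nat.choose (n - 1) (n / 2 - 1) +
      ∑ i ∈ Finset.Icc (n / 2 + 1) (n / 2 + k - 1), Nat.choose n i +
      Nat.choose (n - 1) (n / 2 + k)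

/-- A family of finite sets is intersecting if any two members meet. -/
def Intersecting {α : Type*} [DecidableEq α] (F : Finset (Finset α)) : Prop :=
  ∀ A ∈ F, ∀ B ∈ F, (A ∩ B).Nonempty

/-- A family is butterfly-free if there are no four distinct members
`A,B,C,D` with `A ⊆ C`, `A ⊆ D`, `B ⊆ C`, `B ⊆ D`. -/
def ButterflyFree {α : Type*} (F : Finset (Finset α)) : Prop :=
  ¬ ∃ A B C D : Finset α, A ∈ F ∧ B ∈ F ∧ C ∈ F ∧ D ∈ F ∧
    A ≠ B ∧ A ≠ C ∧ A ≠ D ∧ B ≠ C ∧ B ≠ D ∧ C ≠ D ∧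
    A ⊆ C ∧ A ⊆ D ∧ B ⊆ C ∧ B ⊆ D

/-- A family is `k`-Sperner if it contains no chain of `k+1` distinct sets. -/
def KSperner {α : Type*} (k : ℕ) (F : Finset (Finset α)) : Prop :=
  ¬ ∃ c : Fin (k + 1) → Finset α, (∀ i, c i ∈ F) ∧ StrictMono c

/-- `S ⊆ ZMod n` is an interval if it is `{i, i+1, …, i+j-1}` for some
`i : ZMod n` and `1 ≤ j ≤ n`. -/
def IsInterval (n : ℕ) (S : Finset (ZMod n)) : Prop :=
  ∃ (i : ZMod n) (j : ℕ), 1 ≤ j ∧ j ≤ n ∧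
    S = (Finset.range j).image (fun t : ℕ => i + (t : ZMod n))

/-- The interval `A_i^j = {i, i+1, …, i+j-1}` in `ZMod n`. -/
def IntervalA (n : ℕ) (i : ZMod n) (j : ℕ) : Finset (ZMod n) :=
  (Finset.range j).image (fun t : ℕ => i + (t : ZMod n))

theorem mem_intervalA {n : ℕ} [NeZero n] {i x : ZMod n} {j : ℕ} (hj : j ≤ n) :
    x ∈ IntervalA n i j ↔ (x - i).val < j := by
  simp only [IntervalA, Finset.mem_image, Finset.mem_range]
  constructor
  · rintro ⟨t, ht, rfl⟩
    rw [add_sub_cancel_left, ZMod.val_natCast_of_lt (ht.trans_le hj)]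
    exact ht
  · intro h
    exact ⟨(x - i).val, h, by simp⟩

theorem card_intervalA {n : ℕ} [NeZero n] (i : ZMod n) {j : ℕ} (hj : j ≤ n) :
    (IntervalA n i j).card = j := by
  rw [IntervalA, Finset.card_image_of_injOn, Finset.card_range]
  intro s hs t ht h
  simp only [Finset.coe_range, Set.mem_Iio] at hs ht
  have h' := congrArg ZMod.val (add_left_cancel h)
  rwa [ZMod.val_natCast_of_lt (hs.trans_le hj), ZMod.val_natCast_of_lt (ht.trans_le hj)] at h'

theorem intervalA_mono {n : ℕ} (i : ZMod n) {j l : ℕ} (h : j ≤ l) :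
    IntervalA n i j ⊆ IntervalA n i l :=
  Finset.image_subset_image (Finset.range_subset_range.2 h)

theorem intervalA_succ_subset {n : ℕ} (i : ZMod n) (j : ℕ) :
    IntervalA n (i + 1) j ⊆ IntervalA n i (j + 1) := by
  intro x hx
  simp only [IntervalA, Finset.mem_image, Finset.mem_range] at hx ⊢
  obtain ⟨t, ht, rfl⟩ := hx
  exact ⟨t + 1, by omega, by push_cast; ring⟩

theorem compl_intervalA {n : ℕ} [NeZero n] (i : ZMod n) {j : ℕ} (hj : j ≤ n) :
    (IntervalA n i j)ᶜ = IntervalA n (i + j) (n - j) := by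
  ext x
  rw [Finset.mem_compl, mem_intervalA hj, mem_intervalA (Nat.sub_le n j), not_lt]
  obtain ⟨y, rfl⟩ : ∃ y, x = i + y := ⟨x - i, by ring⟩
  have hy := ZMod.val_lt y
  rw [add_sub_cancel_left, add_sub_add_left_eq_sub]
  rcases le_or_gt j y.val with h | h
  · have : y - (j : ZMod n) = ((y.val - j : ℕ) : ZMod n) := by
      rw [Nat.cast_sub h]; simp
    rw [this, ZMod.val_natCast_of_lt (by omega)]
    omega
  · have : y - (j : ZMod n) = ((y.val + (n - j) : ℕ) : ZMod n) := by
      rw [Nat.cast_add, Nat.cast_sub hj]; simp [sub_eq_add_neg]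
    rw [this, ZMod.val_natCast_of_lt (by omega)]
    omega

theorem IsInterval.exists_start {n : ℕ} [NeZero n] {S : Finset (ZMod n)} (h : IsInterval n S) :
    ∃ i, S = IntervalA n i S.card := by
  obtain ⟨i, j, -, hj, rfl⟩ := h
  have := card_intervalA i hj
  refine ⟨i, ?_⟩
  change IntervalA n i j = IntervalA n i (IntervalA n i j).card
  rw [this]

theorem IsInterval.card_pos {n : ℕ} [NeZero n] {S : Finset (ZMod n)} (h : IsInterval n S) :
    0 < S.card := by
  obtain ⟨i, j, h1, hj, rfl⟩ := h
  exact h1.trans_eq (card_intervalA i hj).symm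

theorem card_le_modulus {n : ℕ} [NeZero n] (S : Finset (ZMod n)) : S.card ≤ n :=
  (Finset.card_le_univ S).trans_eq (ZMod.card n)

theorem IsInterval.compl {n : ℕ} [NeZero n] {S : Finset (ZMod n)} (h : IsInterval n S)
    (hS : S.card < n) : IsInterval n Sᶜ := by
  obtain ⟨i, hi⟩ := h.exists_start
  refine ⟨i + S.card, n - S.card, by omega, by omega, ?_⟩
  conv_lhs => rw [hi]
  exact compl_intervalA i hS.le

theorem exists_injOn_start {n : ℕ} [NeZero n] {F : Finset (Finset (ZMod n))}
    (hF : ∀ S ∈ F, IsInterval n S) (hanti : ∀ S ∈ F, ∀ T ∈ F, S ⊆ T → S = T) :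
    ∃ start : Finset (ZMod n) → ZMod n,
      (∀ S ∈ F, S = IntervalA n (start S) S.card) ∧ Set.InjOn start F := by
  have : ∀ S, ∃ i, S ∈ F → S = IntervalA n i S.card := by
    intro S
    by_cases h : S ∈ F
    · obtain ⟨i, hi⟩ := (hF S h).exists_start
      exact ⟨i, fun _ => hi⟩
    · exact ⟨0, fun h' => absurd h' h⟩
  choose start hstart using this
  refine ⟨start, hstart, fun S hS T hT h => ?_⟩
  have key : ∀ A ∈ F, ∀ B ∈ F, start A = start B → A.card ≤ B.card → A = B := by
    intro A hA B hB hAB hc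
    apply hanti A hA B hB
    rw [hstart A hA, hstart B hB, hAB]
    exact intervalA_mono _ hc
  rcases le_total S.card T.card with hc | hc
  · exact key S hS T hT h hc
  · exact (key T hT S hS h.symm hc).symm

theorem card_antichain_le {n : ℕ} [NeZero n] {F : Finset (Finset (ZMod n))}
    (hF : ∀ S ∈ F, IsInterval n S) (hanti : ∀ S ∈ F, ∀ T ∈ F, S ⊆ T → S = T) :
    F.card ≤ n := by
  obtain ⟨start, -, hinj⟩ := exists_injOn_start hF hanti
  rw [← Finset.card_image_of_injOn hinj]
  exact (Finset.card_le_univ _).trans_eq (ZMod.card n)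

/-- An antichain of `n` intervals consists of all intervals of some fixed length. -/
theorem exists_level_of_card_antichain_eq {n : ℕ} [NeZero n] {F : Finset (Finset (ZMod n))}
    (hF : ∀ S ∈ F, IsInterval n S) (hanti : ∀ S ∈ F, ∀ T ∈ F, S ⊆ T → S = T)
    (hcard : F.card = n) :
    ∃ l, l ≤ n ∧ (∀ i, IntervalA n i l ∈ F) ∧ ∀ S ∈ F, S.card = l := by
  obtain ⟨start, hstart, hinj⟩ := exists_injOn_start hF hanti
  have himg : F.image start = Finset.univ := by
    rw [← Finset.card_eq_iff_eq_univ, Finset.card_image_of_injOn hinj, hcard, ZMod.card]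
  have hex : ∀ i, ∃ S ∈ F, start S = i := fun i => by
    simpa using Finset.mem_image.1 (himg ▸ Finset.mem_univ i)
  choose f hfF hf using hex
  have hfi : ∀ i, f i = IntervalA n i (f i).card := fun i => by
    conv_lhs => rw [hstart _ (hfF i), hf]
  have hstep : ∀ i, (f i).card ≤ (f (i + 1)).card := by
    intro i
    by_contra! hlt
    have hsub : f (i + 1) ⊆ f i := by
      rw [hfi i, hfi (i + 1)]
      exact (intervalA_succ_subset i _).trans (intervalA_mono i hlt)
    have := hanti _ (hfF _) _ (hfF _) hsub
    rw [this] at hlt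
    exact lt_irrefl _ hlt
  have hiter : ∀ (i : ZMod n) (t : ℕ), (f i).card ≤ (f (i + t)).card := by
    intro i t
    induction t with
    | zero => simp
    | succ t ih =>
      refine ih.trans ((hstep _).trans_eq ?_)
      rw [Nat.cast_succ, add_assoc]
  have hle : ∀ i j, (f i).card ≤ (f j).card := by
    intro i j
    simpa using hiter i (j - i).val
  have hconst : ∀ i, (f i).card = (f 0).card := fun i => le_antisymm (hle _ _) (hle _ _)
  refine ⟨(f 0).card, card_le_modulus _, fun i => ?_, fun S hS => ?_⟩
  · rw [← hconst i, ← hfi i]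
    exact hfF i
  · rw [← hconst (start S), ← hinj hS (hfF _) (hf _).symm]

theorem card_level_le {n : ℕ} [NeZero n] {G : Finset (Finset (ZMod n))}
    (hint : ∀ S ∈ G, IsInterval n S) (v : ℕ) :
    (G.filter (fun S => S.card = v)).card ≤ n := by
  apply card_antichain_le
  · intro S hS
    exact hint S (Finset.mem_filter.1 hS).1
  · intro S hS T hT h
    apply Finset.eq_of_subset_of_card_le h
    rw [(Finset.mem_filter.1 hS).2, (Finset.mem_filter.1 hT).2]

theorem card_level_add_card_level_le {n : ℕ} [NeZero n] {G : Finset (Finset (ZMod n))}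
    (hint : ∀ S ∈ G, IsInterval n S) (hmeet : Intersecting G) {v : ℕ} (hv : v ≤ n) :
    (G.filter (fun S => S.card = v)).card + (G.filter (fun S => S.card = n - v)).card ≤ n := by
  have hzero : (G.filter (fun S => S.card = 0)).card = 0 := by
    rw [Finset.card_eq_zero, Finset.filter_eq_empty_iff]
    intro S hS
    exact (hint S hS).card_pos.ne'
  rcases Nat.eq_zero_or_pos v with rfl | hpos
  · rw [hzero, zero_add]
    exact card_level_le hint _
  rcases hv.eq_or_lt with rfl | hlt
  · rw [Nat.sub_self, hzero, add_zero]
    exact card_level_le hint _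
  set P := G.filter (fun S => S.card = v)
  set Q := G.filter (fun S => S.card = n - v)
  have hdisj : Disjoint P (Q.image compl) := by
    rw [Finset.disjoint_left]
    intro S hS hS'
    obtain ⟨T, hT, rfl⟩ := Finset.mem_image.1 hS'
    obtain ⟨x, hx⟩ := hmeet _ (Finset.mem_filter.1 hS).1 _ (Finset.mem_filter.1 hT).1
    exact Finset.mem_compl.1 (Finset.mem_inter.1 hx).1 (Finset.mem_inter.1 hx).2
  rw [← Finset.card_image_of_injective Q compl_injective, ← Finset.card_union_of_disjoint hdisj]
  have hmem : ∀ S ∈ P ∪ Q.image compl, IsInterval n S ∧ S.card = v := by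
    intro S hS
    rcases Finset.mem_union.1 hS with h | h
    · exact ⟨hint S (Finset.mem_filter.1 h).1, (Finset.mem_filter.1 h).2⟩
    · obtain ⟨T, hT, rfl⟩ := Finset.mem_image.1 h
      obtain ⟨hTG, hTc⟩ := Finset.mem_filter.1 hT
      refine ⟨(hint T hTG).compl (by omega), ?_⟩
      rw [Finset.card_compl, ZMod.card, hTc]
      omega
  apply card_antichain_le
  · exact fun S hS => (hmem S hS).1
  · intro S hS T hT h
    apply Finset.eq_of_subset_of_card_le h
    rw [(hmem S hS).2, (hmem T hT).2]

theorem sum_card_eq_sum_levels {n : ℕ} [NeZero n] (G : Finset (Finset (ZMod n))) (g : ℕ → ℕ) :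
    ∑ S ∈ G, g S.card =
      ∑ v ∈ Finset.range (n + 1), (G.filter (fun S => S.card = v)).card * g v := by
  rw [← Finset.sum_fiberwise_of_maps_to (t := Finset.range (n + 1)) (g := Finset.card)
    (fun S _ => Finset.mem_range.2 (Nat.lt_succ_of_le (card_le_modulus S)))]
  refine Finset.sum_congr rfl fun v _ => ?_
  rw [Finset.sum_congr rfl (fun S hS => by rw [(Finset.mem_filter.1 hS).2]), Finset.sum_const,
    smul_eq_mul]

theorem two_mul_sum_card_le {n : ℕ} [NeZero n] {G : Finset (Finset (ZMod n))}
    (hint : ∀ S ∈ G, IsInterval n S) (hmeet : Intersecting G) (g : ℕ → ℕ)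
    (hg : ∀ v ≤ n, g (n - v) = g v) :
    2 * ∑ S ∈ G, g S.card ≤ n * ∑ v ∈ Finset.range (n + 1), g v := by
  rw [two_mul]
  nth_rewrite 2 [sum_card_eq_sum_levels]
  rw [← Finset.sum_range_reflect, sum_card_eq_sum_levels, ← Finset.sum_add_distrib,
    Finset.mul_sum]
  refine Finset.sum_le_sum fun v hv => ?_
  have hv' : v ≤ n := Nat.lt_succ_iff.1 (Finset.mem_range.1 hv)
  rw [Nat.add_sub_cancel, hg v hv', ← add_mul]
  exact Nat.mul_le_mul_right _ (card_level_add_card_level_le hint hmeet hv')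

theorem choose_antitone {n a b : ℕ} (ha : n ≤ 2 * a + 1) (hab : a ≤ b) :
    n.choose b ≤ n.choose a := by
  induction b, hab using Nat.le_induction with
  | base => exact le_rfl
  | succ b hb ih =>
    refine le_trans ?_ ih
    have h := Nat.choose_succ_right_eq n b
    have h2 : n.choose b * (n - b) ≤ n.choose b * (b + 1) :=
      Nat.mul_le_mul_left _ (by omega)
    rw [← h] at h2
    exact Nat.le_of_mul_le_mul_right h2 (Nat.succ_pos b)

/-- Splitting every weight at the threshold `c`. -/
theorem sum_choose_card_le {n : ℕ} (G : Finset (Finset (ZMod n))) (c : ℕ) :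
    ∑ S ∈ G, n.choose S.card ≤ G.card * c + ∑ S ∈ G, (n.choose S.card - c) := by
  rw [← smul_eq_mul, ← Finset.sum_const, ← Finset.sum_add_distrib]
  exact Finset.sum_le_sum fun S _ => by omega

theorem sum_choose_card_le_of_card_ge {n : ℕ} [NeZero n] {G : Finset (Finset (ZMod n))}
    (hint : ∀ S ∈ G, IsInterval n S) {L r : ℕ} (hL : n ≤ 2 * L + 1)
    (hsize : ∀ S ∈ G, L ≤ S.card) (hcard : G.card ≤ r * n) :
    ∑ S ∈ G, n.choose S.card ≤ n * ∑ i ∈ Finset.range r, n.choose (L + i) := by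
  set c := n.choose (L + r) with hc
  have h1 : ∑ S ∈ G, (n.choose S.card - c) ≤
      n * ∑ i ∈ Finset.range r, (n.choose (L + i) - c) := by
    have hle : ∑ S ∈ G, (n.choose S.card - c) ≤
        ∑ S ∈ G.filter (fun S => S.card ∈ (Finset.range r).image (L + ·)),
          (n.choose S.card - c) := by
      refine Finset.sum_le_sum_of_ne_zero fun S hS hne => ?_
      refine Finset.mem_filter.2 ⟨hS, Finset.mem_image.2 ⟨S.card - L, ?_, ?_⟩⟩
      · rw [Finset.mem_range]
        by_contra! hge
        have := hsize S hS
        exact hne (Nat.sub_eq_zero_of_le (choose_antitone (by omega) (by omega)))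
      · have := hsize S hS
        omega
    refine hle.trans ?_
    rw [← Finset.sum_fiberwise_of_maps_to (t := (Finset.range r).image (L + ·)) (g := Finset.card)
      (fun S hS => (Finset.mem_filter.1 hS).2),
      Finset.sum_image (fun a _ b _ h => by simpa using h), Finset.mul_sum]
    refine Finset.sum_le_sum fun i _ => ?_
    rw [Finset.sum_congr rfl (fun S hS => by rw [(Finset.mem_filter.1 hS).2]), Finset.sum_const,
      smul_eq_mul]
    refine Nat.mul_le_mul_right _ (le_trans (Finset.card_le_card ?_) (card_level_le hint (L + i)))
    exact Finset.filter_subset_filter _ (Finset.filter_subset _ _)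
  have h2 : ∑ i ∈ Finset.range r, (n.choose (L + i) - c) + r * c =
      ∑ i ∈ Finset.range r, n.choose (L + i) := by
    have : r * c = ∑ _i ∈ Finset.range r, c := by simp
    rw [this, ← Finset.sum_add_distrib]
    refine Finset.sum_congr rfl fun i hi => Nat.sub_add_cancel ?_
    exact choose_antitone (by omega) (by have := Finset.mem_range.1 hi; omega)
  have h3 := sum_choose_card_le G c
  have h4 := Nat.mul_le_mul_right c hcard
  rw [← h2]
  linarith [mul_add n (∑ i ∈ Finset.range r, (n.choose (L + i) - c)) (r * c),
    mul_comm r n, mul_assoc n r c]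

/-- The sum of a symmetric function over an even number of levels, folded at the middle. -/
theorem sum_range_odd {m : ℕ} (g : ℕ → ℕ) (hg : ∀ v ≤ 2 * m + 1, g (2 * m + 1 - v) = g v) :
    ∑ v ∈ Finset.range (2 * m + 1 + 1), g v = 2 * ∑ i ∈ Finset.range (m + 1), g (m + 1 + i) := by
  rw [show 2 * m + 1 + 1 = (m + 1) + (m + 1) by ring, Finset.sum_range_add, two_mul]
  congr 1
  rw [← Finset.sum_range_reflect]
  refine Finset.sum_congr rfl fun i hi => ?_
  have := Finset.mem_range.1 hi
  rw [← hg _ (by omega)]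
  congr 1
  omega

theorem sum_range_even {n m : ℕ} (hn : n = 2 * m) (g : ℕ → ℕ)
    (hg : ∀ v ≤ n, g (n - v) = g v) :
    ∑ v ∈ Finset.range (n + 1), g v = g m + 2 * ∑ i ∈ Finset.range m, g (m + 1 + i) := by
  subst hn
  rw [show 2 * m + 1 = m + 1 + m by ring, Finset.sum_range_add, Finset.sum_range_succ]
  have : ∑ v ∈ Finset.range m, g v = ∑ i ∈ Finset.range m, g (m + 1 + i) := by
    rw [← Finset.sum_range_reflect]
    refine Finset.sum_congr rfl fun i hi => ?_
    have := Finset.mem_range.1 hi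
    rw [← hg _ (by omega)]
    congr 1
    omega
  rw [this]
  ring

theorem sum_range_sub_le {n L r s : ℕ} (hL : n ≤ 2 * L + 1) :
    ∑ i ∈ Finset.range s, (n.choose (L + i) - n.choose (L + r)) + r * n.choose (L + r) ≤
      ∑ i ∈ Finset.range r, n.choose (L + i) := by
  have h1 : ∑ i ∈ Finset.range s, (n.choose (L + i) - n.choose (L + r)) ≤
      ∑ i ∈ Finset.range r, (n.choose (L + i) - n.choose (L + r)) := by
    refine Finset.sum_le_sum_of_ne_zero fun i _ hne => ?_
    rw [Finset.mem_range]
    by_contra! hge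
    exact hne (Nat.sub_eq_zero_of_le (choose_antitone (by omega) (by omega)))
  refine (Nat.add_le_add_right h1 _).trans_eq ?_
  have : r * n.choose (L + r) = ∑ _i ∈ Finset.range r, n.choose (L + r) := by simp
  rw [this, ← Finset.sum_add_distrib]
  refine Finset.sum_congr rfl fun i hi => Nat.sub_add_cancel ?_
  exact choose_antitone (by omega) (by have := Finset.mem_range.1 hi; omega)

theorem sum_choose_card_le_odd {m k : ℕ} {G : Finset (Finset (ZMod (2 * m + 1)))}
    (hint : ∀ S ∈ G, IsInterval (2 * m + 1) S) (hmeet : Intersecting G)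
    (hcard : G.card ≤ k * (2 * m + 1)) :
    ∑ S ∈ G, (2 * m + 1).choose S.card ≤
      (2 * m + 1) * ∑ i ∈ Finset.range k, (2 * m + 1).choose (m + 1 + i) := by
  set c := (2 * m + 1).choose (m + 1 + k) with hc
  have hsymm : ∀ v ≤ 2 * m + 1,
      (2 * m + 1).choose (2 * m + 1 - v) - c = (2 * m + 1).choose v - c := fun v hv => by
    rw [Nat.choose_symm hv]
  have h1 := two_mul_sum_card_le hint hmeet (fun v => (2 * m + 1).choose v - c) hsymm
  rw [sum_range_odd _ hsymm] at h1
  have h2 := sum_range_sub_le (n := 2 * m + 1) (L := m + 1) (r := k) (s := m + 1) (by omega)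
  rw [← hc] at h2
  have h3 := sum_choose_card_le G c
  have h4 := Nat.mul_le_mul_right c hcard
  have h5 := Nat.mul_le_mul_left (2 * m + 1) h2
  linarith [mul_add (2 * m + 1) (∑ i ∈ Finset.range (m + 1), ((2 * m + 1).choose (m + 1 + i) - c))
    (k * c), mul_comm k (2 * m + 1), mul_assoc (2 * m + 1) k c,
    mul_left_comm (2 * m + 1) 2
      (∑ i ∈ Finset.range (m + 1), ((2 * m + 1).choose (m + 1 + i) - c))]

theorem sigmaI_odd (m k : ℕ) :
    SigmaI (2 * m + 1) (k + 1) = ∑ i ∈ Finset.range (k + 1), (2 * m + 1).choose (m + 1 + i) := by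
  rw [SigmaI, if_pos (by omega), show (2 * m + 1 + 1) / 2 = m + 1 by omega,
    ← Finset.Ico_add_one_right_eq_Icc, Finset.sum_Ico_eq_sum_range]
  congr 2
  omega

theorem sigmaI_even_eq (m k : ℕ) :
    SigmaI (2 * (m + 1)) (k + 1) = (2 * m + 1).choose m +
      ∑ i ∈ Finset.range k, (2 * (m + 1)).choose (m + 2 + i) +
      (2 * m + 1).choose (m + 2 + k) := by
  rw [SigmaI, if_neg (by omega), show 2 * (m + 1) / 2 = m + 1 by omega,
    ← Finset.Ico_add_one_right_eq_Icc, Finset.sum_Ico_eq_sum_range]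
  congr 2
  · congr 2
    omega
  · omega

theorem sigmaI_even (m k : ℕ) :
    SigmaI (2 * (m + 1)) (k + 1) = ∑ i ∈ Finset.range (k + 1),
      ((2 * m + 1).choose (m + i) + (2 * m + 1).choose (m + 2 + i)) := by
  induction k with
  | zero => rw [sigmaI_even_eq]; simp
  | succ k ih =>
    rw [Finset.sum_range_succ, ← ih, sigmaI_even_eq, sigmaI_even_eq, Finset.sum_range_succ]
    have h : (2 * (m + 1)).choose (m + 2 + k) =
        (2 * m + 1).choose (m + (k + 1)) + (2 * m + 1).choose (m + 2 + k) := by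
      rw [show 2 * (m + 1) = (2 * m + 1) + 1 by ring, show m + 2 + k = (m + (k + 1)) + 1 by ring,
        Nat.choose_succ_succ']
    rw [h]
    ring_nf

theorem sum_choose_card_le_even {n m t : ℕ} [NeZero n] (hn : n = 2 * (m + 1))
    {G : Finset (Finset (ZMod n))} (hint : ∀ S ∈ G, IsInterval n S) (hmeet : Intersecting G)
    (hcard : t ≤ m + 1 → G.card + t ≤ t * n) :
    ∑ S ∈ G, n.choose S.card ≤ n * ∑ i ∈ Finset.range t,
      ((2 * m + 1).choose (m + i) + (2 * m + 1).choose (m + 2 + i)) := by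
  rcases t with _ | r
  · have : G = ∅ := by simpa using hcard (Nat.zero_le _)
    simp [this]
  rw [← sigmaI_even, sigmaI_even_eq, ← hn]
  set c := n.choose (m + 2 + r) with hc
  have hsymm : ∀ v ≤ n, n.choose (n - v) - c = n.choose v - c := fun v hv => by
    rw [Nat.choose_symm hv]
  have h1 := two_mul_sum_card_le hint hmeet (fun v => n.choose v - c) hsymm
  rw [sum_range_even hn _ hsymm] at h1
  have h2 := sum_range_sub_le (n := n) (L := m + 2) (r := r) (s := m + 1) (by omega)
  rw [← hc] at h2
  have h3 := sum_choose_card_le G c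
  have hmid : n.choose (m + 1) - c + c = n.choose (m + 1) :=
    Nat.sub_add_cancel (choose_antitone (by omega) (by omega))
  have e1 : n * (2 * m + 1).choose m = n.choose (m + 1) * (m + 1) := by
    rw [hn]
    exact Nat.add_one_mul_choose_eq (2 * m + 1) m
  have e2 : n * (2 * m + 1).choose (m + 2 + r) = c * (m - r) := by
    have := Nat.choose_mul_succ_eq (2 * m + 1) (m + 2 + r)
    rw [show 2 * m + 1 + 1 - (m + 2 + r) = m - r by omega, show 2 * m + 1 + 1 = n by omega] at this
    rw [mul_comm]
    exact this
  have h4 : G.card * c ≤ (r * n + (m + 1) + (m - r)) * c := by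
    rcases le_or_gt (r + 1) (m + 1) with h | h
    · apply Nat.mul_le_mul_right
      have := hcard h
      have hx : (r + 1) * n = r * n + n := by ring
      omega
    · rw [hc, Nat.choose_eq_zero_of_lt (by omega)]
      simp
  have h5 := Nat.mul_le_mul_left n h2
  rw [mul_add, mul_add, e1, e2]
  set X := ∑ i ∈ Finset.range (m + 1), (n.choose (m + 2 + i) - c)
  set a := n.choose (m + 1) - c
  rw [← hmid]
  have h1' : 2 * ∑ S ∈ G, (n.choose S.card - c) ≤ 2 * ((m + 1) * a + n * X) := by
    refine h1.trans_eq ?_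
    rw [hn]; ring
  have e3 : (r * n + (m + 1) + (m - r)) * c = n * (r * c) + (m + 1) * c + c * (m - r) := by ring
  have e4 : (a + c) * (m + 1) = (m + 1) * a + (m + 1) * c := by ring
  rw [mul_add] at h5
  rw [e4]
  omega

/-- A rank function splitting a `k`-Sperner family into `k` antichains. -/
theorem KSperner.exists_rank {α : Type*} {k : ℕ} {G : Finset (Finset α)} (h : KSperner k G) :
    ∃ rk : Finset α → ℕ, (∀ S ∈ G, rk S < k) ∧
      (∀ S ∈ G, ∀ T ∈ G, S ⊂ T → rk S < rk T) ∧
      (∀ S ∈ G, ∀ t < rk S, ∃ T ∈ G, T ⊂ S ∧ rk T = t) := by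
  classical
  have hlt : ∀ x : {S // S ∈ G}, Order.height x < (k : ℕ∞) := by
    intro x
    by_contra! hge
    obtain ⟨p, -, hp⟩ := Order.exists_series_of_le_height x hge
    subst hp
    exact h ⟨fun i => (p i).1, fun i => (p i).2, fun i j hij => p.strictMono hij⟩
  have hcoe : ∀ x : {S // S ∈ G}, ((Order.height x).toNat : ℕ∞) = Order.height x := fun x =>
    ENat.natCast_toNat (hlt x).ne_top
  refine ⟨fun S => if hS : S ∈ G then (Order.height (⟨S, hS⟩ : {S // S ∈ G})).toNat else 0,
    ?_, ?_, ?_⟩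
  · intro S hS
    have := hlt ⟨S, hS⟩
    rw [← hcoe] at this
    simpa [hS] using this
  · intro S hS T hT hST
    have := Order.height_strictMono (show (⟨S, hS⟩ : {S // S ∈ G}) < ⟨T, hT⟩ from hST)
      ((hlt _).trans (ENat.natCast_lt_top k))
    rw [← hcoe, ← hcoe ⟨T, hT⟩] at this
    simpa [hS, hT] using this
  · intro S hS t ht
    simp only [hS, dite_true] at ht
    have ht' : (t : ℕ∞) < Order.height (⟨S, hS⟩ : {S // S ∈ G}) := by
      rw [← hcoe]; exact_mod_cast ht
    obtain ⟨y, hy, hyt⟩ := (Order.coe_lt_height_iff ((hlt _).trans (ENat.natCast_lt_top k))).1 ht'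
    refine ⟨y.1, y.2, hy, ?_⟩
    simp [hyt]

theorem card_filter_le_of_layers {α : Type*} {G : Finset α} {rk : α → ℕ} {a b c : ℕ}
    (h : ∀ t, a ≤ t → t < b → (G.filter (fun S => rk S = t)).card ≤ c) :
    (G.filter (fun S => a ≤ rk S ∧ rk S < b)).card ≤ (b - a) * c := by
  classical
  rw [Finset.card_eq_sum_card_fiberwise (f := rk) (t := Finset.Ico a b)
    (fun S hS => by simpa using (Finset.mem_filter.1 hS).2), ← Nat.card_Ico a b, ← smul_eq_mul]
  refine Finset.sum_le_card_nsmul _ _ _ fun t ht => ?_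
  obtain ⟨h1, h2⟩ := Finset.mem_Ico.1 ht
  exact (Finset.card_le_card (Finset.filter_subset_filter _ (Finset.filter_subset _ _))).trans
    (h t h1 h2)

/-- An intersecting family containing all intervals of length `l` has no member of size at most `n - l`. -/
theorem lt_card_add_of_level_subset {n : ℕ} [NeZero n] {G : Finset (Finset (ZMod n))}
    (hint : ∀ S ∈ G, IsInterval n S) (hmeet : Intersecting G) {l : ℕ}
    (hl : ∀ i, IntervalA n i l ∈ G) {S : Finset (ZMod n)} (hS : S ∈ G) : n < S.card + l := by
  by_contra! hle
  obtain ⟨i, hi⟩ := (hint S hS).exists_start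
  obtain ⟨x, hx⟩ := hmeet S hS _ (hl (i + S.card))
  obtain ⟨hxS, hxl⟩ := Finset.mem_inter.1 hx
  have hsub : x ∈ (IntervalA n i S.card)ᶜ := by
    rw [compl_intervalA i (card_le_modulus S)]
    exact intervalA_mono _ (by omega) hxl
  rw [← hi] at hsub
  exact Finset.mem_compl.1 hsub hxS

theorem sum_choose_card_le_even_of_kSperner {n m k : ℕ} [NeZero n] (hn : n = 2 * (m + 1))
    {G : Finset (Finset (ZMod n))} (hint : ∀ S ∈ G, IsInterval n S) (hmeet : Intersecting G) (hS : KSperner k G) :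
    ∑ S ∈ G, n.choose S.card ≤ n * ∑ i ∈ Finset.range k,
      ((2 * m + 1).choose (m + i) + (2 * m + 1).choose (m + 2 + i)) := by
  rcases le_or_gt k (m + 1) with hkm | hkm
  swap
  · exact sum_choose_card_le_even hn hint hmeet (fun h => absurd h (by omega))
  obtain ⟨rk, hrk, hmono, hex⟩ := hS.exists_rank
  have hlint : ∀ t, ∀ S ∈ G.filter (fun S => rk S = t), IsInterval n S := fun t S h =>
    hint S (Finset.mem_filter.1 h).1
  have hanti : ∀ t, ∀ S ∈ G.filter (fun S => rk S = t), ∀ T ∈ G.filter (fun S => rk S = t),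
      S ⊆ T → S = T := by
    intro t S h T h' hsub
    obtain ⟨h1, h2⟩ := Finset.mem_filter.1 h
    obtain ⟨h3, h4⟩ := Finset.mem_filter.1 h'
    by_contra hne
    have := hmono S h1 T h3 (hsub.ssubset_of_ne hne)
    omega
  have hlayer : ∀ t, (G.filter (fun S => rk S = t)).card ≤ n := fun t =>
    card_antichain_le (hlint t) (hanti t)
  by_cases hfull : ∃ t, (G.filter (fun S => rk S = t)).card = n
  swap
  · push Not at hfull
    refine sum_choose_card_le_even hn hint hmeet fun _ => ?_
    have := card_filter_le_of_layers (G := G) (rk := rk) (a := 0) (b := k) (c := n - 1)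
      (fun t _ _ => by have := hlayer t; have := hfull t; omega)
    rw [Finset.filter_true_of_mem (fun S hS => ⟨Nat.zero_le _, hrk S hS⟩), Nat.sub_zero,
      Nat.mul_sub_one] at this
    have hk : k ≤ k * n := Nat.le_mul_of_pos_right _ (by omega)
    omega
  · classical
    set t := Nat.find hfull with ht
    obtain ⟨l, hln, hlmem, hlcard⟩ := exists_level_of_card_antichain_eq (hlint t) (hanti t)
      (Nat.find_spec hfull)
    have hlG : ∀ i, IntervalA n i l ∈ G := fun i => (Finset.mem_filter.1 (hlmem i)).1
    have hlrk : ∀ i, rk (IntervalA n i l) = t := fun i => (Finset.mem_filter.1 (hlmem i)).2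
    have htk : t < k := hlrk 0 ▸ hrk _ (hlG 0)
    have hml : m + 2 ≤ l := by
      have := lt_card_add_of_level_subset hint hmeet hlG (hlG 0)
      rw [card_intervalA _ hln] at this
      omega
    set B := G.filter (fun S => 0 ≤ rk S ∧ rk S < t) with hB
    set U := G.filter (fun S => t ≤ rk S ∧ rk S < k) with hU
    have hBcard : B.card ≤ t * (n - 1) :=
      card_filter_le_of_layers (a := 0) fun s _ hs => by
        have := hlayer s
        have := Nat.find_min hfull hs
        omega
    have hUcard : U.card ≤ (k - t) * n := card_filter_le_of_layers fun s _ _ => hlayer s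
    have hdisj : Disjoint B U := by
      rw [Finset.disjoint_left]
      intro S h h'
      have := (Finset.mem_filter.1 h).2
      have := (Finset.mem_filter.1 h').2
      omega
    have hunion : B ∪ U = G := by
      ext S
      simp only [hB, hU, Finset.mem_union, Finset.mem_filter]
      constructor
      · rintro (h | h) <;> exact h.1
      · intro h
        have := hrk S h
        rcases lt_or_ge (rk S) t with h' | h'
        · exact Or.inl ⟨h, by omega, h'⟩
        · exact Or.inr ⟨h, h', this⟩
    have hBint : ∀ S ∈ B, IsInterval n S := fun S h => hint S (Finset.mem_filter.1 h).1
    have hBmeet : Intersecting B := fun S h T h' =>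
      hmeet S (Finset.mem_filter.1 h).1 T (Finset.mem_filter.1 h').1
    have hUint : ∀ S ∈ U, IsInterval n S := fun S h => hint S (Finset.mem_filter.1 h).1
    have hUsize : ∀ S ∈ U, l ≤ S.card := by
      intro S h
      obtain ⟨h1, h2, -⟩ := Finset.mem_filter.1 h
      rcases h2.eq_or_lt with h3 | h3
      · exact (hlcard S (Finset.mem_filter.2 ⟨h1, h3.symm⟩)).ge
      · obtain ⟨T, hT, hTS, hTt⟩ := hex S h1 t h3
        rw [← hlcard T (Finset.mem_filter.2 ⟨hT, hTt⟩)]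
        exact Finset.card_le_card hTS.subset
    have hBsize : ∀ S ∈ B, S.card < l := by
      intro S h
      obtain ⟨h1, -, h2⟩ := Finset.mem_filter.1 h
      by_contra! hge
      obtain ⟨i, hi⟩ := (hint S h1).exists_start
      have hsub : IntervalA n i l ⊆ S := by
        rw [hi]
        exact intervalA_mono i hge
      have hne : IntervalA n i l ≠ S := by
        rintro rfl
        exact absurd (hlrk i) h2.ne
      have := hmono _ (hlG i) S h1 (hsub.ssubset_of_ne hne)
      rw [hlrk] at this
      omega
    rcases le_or_gt l (m + 1 + t) with hlt | hlt
    · refine sum_choose_card_le_even hn hint hmeet fun _ => ?_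
      have hBmid : 2 * B.card ≤ n * (1 + 2 * (l - m - 2)) := by
        have h1 := two_mul_sum_card_le hBint hBmeet (fun v => if n < v + l ∧ v < l then 1 else 0)
          (fun v hv => by
            have : (n < n - v + l ∧ n - v < l) ↔ (n < v + l ∧ v < l) := by omega
            exact if_congr this rfl rfl)
        rw [Finset.sum_congr rfl (g := fun _ => 1), Finset.sum_const, smul_eq_mul, mul_one] at h1
        · refine h1.trans (Nat.mul_le_mul_left _ ?_)
          rw [← Finset.card_filter]
          refine (Finset.card_le_card (t := Finset.Ico (n + 1 - l) l) ?_).trans ?_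
          · intro v hv
            have := (Finset.mem_filter.1 hv).2
            exact Finset.mem_Ico.2 (by omega)
          · rw [Nat.card_Ico]
            omega
        · intro S h
          have h1 := hBsize S h
          have h2 := lt_card_add_of_level_subset hint hmeet hlG (Finset.mem_filter.1 h).1
          exact if_pos ⟨h2, h1⟩
      have h2 : 1 + 2 * (l - m - 2) ≤ 2 * t - 1 := by omega
      have h3 : 2 * B.card ≤ n * (2 * t - 1) := hBmid.trans (Nat.mul_le_mul_left _ h2)
      have ht0 : 1 ≤ t := by omega
      rw [← hunion, Finset.card_union_of_disjoint hdisj]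
      obtain ⟨s, hs⟩ : ∃ s, t = s + 1 := ⟨t - 1, by omega⟩
      obtain ⟨d, hd⟩ : ∃ d, k = t + d := ⟨k - t, by omega⟩
      have h4 : k - t = d := by omega
      have h5 : 2 * t - 1 = 2 * s + 1 := by omega
      rw [h4] at hUcard
      rw [h5] at h3
      have e1 : n * (2 * s + 1) = 2 * (s * n) + n := by ring
      have e2 : k * n = s * n + n + d * n := by rw [hd, hs]; ring
      omega
    · rw [← hunion, Finset.sum_union hdisj]
      have hb := sum_choose_card_le_even (t := t) hn hBint hBmeet (fun _ => by
        have : t ≤ t * n := Nat.le_mul_of_pos_right _ (by omega)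
        rw [Nat.mul_sub_one] at hBcard
        omega)
      have hu := sum_choose_card_le_of_card_ge hUint (L := m + 2 + t) (r := k - t) (by omega)
        (fun S h => le_trans (by omega) (hUsize S h)) hUcard
      refine (Nat.add_le_add hb hu).trans ?_
      rw [← mul_add]
      refine Nat.mul_le_mul_left _ ?_
      conv_rhs => rw [show k = t + (k - t) by omega, Finset.sum_range_add]
      refine Nat.add_le_add_left (Finset.sum_le_sum fun i _ => ?_) _
      rw [show n = 2 * m + 1 + 1 by omega, show m + 2 + t + i = (m + 1 + (t + i)) + 1 by ring,
        Nat.choose_succ_succ', show m + 2 + (t + i) = m + 1 + (t + i) + 1 by ring]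
      exact Nat.add_le_add_right (choose_antitone (by omega) (by omega)) _

theorem KSperner.card_le {n k : ℕ} [NeZero n] {G : Finset (Finset (ZMod n))}
    (hint : ∀ S ∈ G, IsInterval n S) (hS : KSperner k G) : G.card ≤ k * n := by
  obtain ⟨rk, hrk, hmono, -⟩ := hS.exists_rank
  have := card_filter_le_of_layers (G := G) (rk := rk) (a := 0) (b := k) (c := n) fun t _ _ => by
    refine card_antichain_le (fun S h => hint S (Finset.mem_filter.1 h).1) fun S h T h' hsub => ?_
    obtain ⟨h1, h2⟩ := Finset.mem_filter.1 h
    obtain ⟨h3, h4⟩ := Finset.mem_filter.1 h'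
    by_contra hne
    have := hmono S h1 T h3 (hsub.ssubset_of_ne hne)
    omega
  rwa [Finset.filter_true_of_mem (fun S hS => ⟨Nat.zero_le _, hrk S hS⟩)] at this

theorem intersecting_kSperner_intervals_weight_le (n k : ℕ) (hk : 1 ≤ k)
    (G : Finset (Finset (ZMod n)))
    (hint : ∀ S ∈ G, IsInterval n S)
    (hmeet : Intersecting G)
    (hS : KSperner k G) :
    ∑ S ∈ G, Nat.choose n S.card ≤ n * SigmaI n k := by
  obtain ⟨k, rfl⟩ := Nat.exists_eq_add_of_le' hk
  rcases Nat.even_or_odd' n with ⟨m, rfl | rfl⟩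
  · rcases m with _ | m
    · have : G = ∅ := Finset.eq_empty_of_forall_notMem fun S h => by
        obtain ⟨i, j, h1, h2, -⟩ := hint S h
        omega
      simp [this]
    · rw [sigmaI_even]
      exact sum_choose_card_le_even_of_kSperner rfl hint hmeet hS
  · rw [sigmaI_odd]
    exact sum_choose_card_le_odd hint hmeet (hS.card_le hint)
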